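/- Let Y = ℕ^ℤ with the cylinder σ-algebra, τ the right shift, ν a τ-invariant probability measure, η the partition of Y into the cylinders C_i = {y : y_0 = i}, and f : Y → ℤ₊ a function constant on each atom of η, with value f_i on C_i. Assume Σ_{i=1}^∞ f_i·ν(C_i) < ∞ and Σ_{i=1}^∞ f_i·ν(C_i)·|ln ν(C_i)| = ∞. Let Ŷ = {(y, u) : y ∈ Y, u ∈ ℤ₊, u ≤ f(y)}, let ν̂ = (1/(ν(f)+1))·(ν × λ) restricted to Ŷ where λ is counting measure on ℤ₊, and let η̂ be the partition of Ŷ into the sets C_{i,k} = {(y, u) : y ∈ C_i, u = k}, i ∈ ℕ, 0 ≤ k ≤ f_i. Then H_{ν̂}(η̂) = ∞. -/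

import Mathlib

open MeasureTheory Filter Set
open scoped ENNReal

noncomputable section

/-- The sequence space `Y = ℕ^ℤ` with the cylinder (product) σ-algebra. -/
abbrev IntSeq : Type := ℤ → ℕ

/-- The right one-step shift `(τ y)ᵢ = y_{i-1}`. -/
def shift : IntSeq → IntSeq := fun y i => y (i - 1)

/-- The inverse (left) shift. -/
def shiftInv : IntSeq → IntSeq := fun y i => y (i + 1)

/-- The one-dimensional cylinder `C_i = {y : y₀ = i}`. -/
def cyl0 (i : ℕ) : Set IntSeq := {y | y 0 = i}

/-- The phase space `Ŷ = {(y, u) : u ≤ f(y)}` of the integral (suspension) automorphism,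
for a function `f` constant on each `C_i` with value `fv i`, realized inside `Y × ℤ₊`. -/
def suspSet (fv : ℕ → ℕ) : Set (IntSeq × ℕ) := {p | p.2 ≤ fv (p.1 0)}

/-- The measure `ν̂ = (ν × λ)|_Ŷ / (ν(f) + 1)`, where `λ` is counting measure on `ℤ₊`
and `ν(f) = ∑ᵢ fᵢ ν(Cᵢ)`. -/
def suspMeasure (ν : Measure IntSeq) (fv : ℕ → ℕ) : Measure (IntSeq × ℕ) :=
  ((∑' i : ℕ, (fv i : ℝ≥0∞) * ν (cyl0 i)) + 1)⁻¹ •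
    ((ν.prod Measure.count).restrict (suspSet fv))

/-- The atom `C_{i,k} = {(y, u) : y ∈ C_i, u = k}` of the partition `η̂` of `Ŷ`. -/
def suspAtom (i k : ℕ) : Set (IntSeq × ℕ) := {p | p.1 0 = i ∧ p.2 = k}

lemma suspMeasure_suspAtom (ν : Measure IntSeq) [SFinite ν] {fv : ℕ → ℕ} {i k : ℕ}
    (hk : k ≤ fv i) :
    suspMeasure ν fv (suspAtom i k) =
      ((∑' i : ℕ, (fv i : ℝ≥0∞) * ν (cyl0 i)) + 1)⁻¹ * ν (cyl0 i) := by
  have hprod : suspAtom i k = cyl0 i ×ˢ {k} := by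
    ext p
    simp [suspAtom, cyl0]
  have hmeas : MeasurableSet (suspAtom i k) := by
    rw [hprod]
    exact (measurableSet_eq_fun (measurable_pi_apply 0) measurable_const).prod
      (measurableSet_singleton k)
  have hsub : suspAtom i k ⊆ suspSet fv := by
    rintro p ⟨rfl, rfl⟩
    exact hk
  rw [suspMeasure, Measure.smul_apply, Measure.restrict_apply hmeas,
    inter_eq_left.mpr hsub, hprod, Measure.prod_prod, Measure.count_singleton, mul_one,
    smul_eq_mul]

lemma mul_abs_log_le_negMulLog_mul {c p : ℝ} (hc0 : 0 < c) (hc1 : c ≤ 1) (hp0 : 0 ≤ p)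
    (hp1 : p ≤ 1) : c * (p * |Real.log p|) ≤ Real.negMulLog (c * p) := by
  rcases hp0.eq_or_lt with rfl | hp
  · simp
  · rw [abs_of_nonpos (Real.log_nonpos hp0 hp1), Real.negMulLog,
      Real.log_mul hc0.ne' hp.ne']
    nlinarith [mul_nonneg (mul_pos hc0 hp).le (neg_nonneg.mpr (Real.log_nonpos hc0.le hc1))]

lemma mul_ofReal_abs_log_le_ofReal_negMulLog {c p : ℝ≥0∞} (hc0 : c ≠ 0) (hc1 : c ≤ 1)
    (hp1 : p ≤ 1) :
    c * (p * ENNReal.ofReal |Real.log p.toReal|) ≤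
      ENNReal.ofReal (Real.negMulLog (c * p).toReal) := by
  have hc : c ≠ ⊤ := ne_top_of_le_ne_top ENNReal.one_ne_top hc1
  have hp : p ≠ ⊤ := ne_top_of_le_ne_top ENNReal.one_ne_top hp1
  calc c * (p * ENNReal.ofReal |Real.log p.toReal|)
      = ENNReal.ofReal (c.toReal * (p.toReal * |Real.log p.toReal|)) := by
        rw [ENNReal.ofReal_mul ENNReal.toReal_nonneg, ENNReal.ofReal_mul ENNReal.toReal_nonneg,
          ENNReal.ofReal_toReal hc, ENNReal.ofReal_toReal hp]
    _ ≤ ENNReal.ofReal (Real.negMulLog (c * p).toReal) := by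
        rw [ENNReal.toReal_mul]
        exact ENNReal.ofReal_le_ofReal <| mul_abs_log_le_negMulLog_mul
          (ENNReal.toReal_pos hc0 hc) (ENNReal.toReal_le_of_le_ofReal zero_le_one (by simpa))
          ENNReal.toReal_nonneg (ENNReal.toReal_le_of_le_ofReal zero_le_one (by simpa))

/-- **Example.** If `∑ᵢ fᵢ ν(Cᵢ) < ∞` but `∑ᵢ fᵢ ν(Cᵢ) |ln ν(Cᵢ)| = ∞`, then the
partition `η̂ = {C_{i,k} : i ∈ ℕ, 0 ≤ k ≤ fᵢ}` of the suspension space `Ŷ` has infinite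
entropy with respect to the suspension measure `ν̂`. -/
theorem suspension_partition_entropy_eq_top
    (ν : Measure IntSeq) [IsProbabilityMeasure ν] (hinv : MeasurePreserving shift ν ν)
    (fv : ℕ → ℕ) (f : IntSeq → ℕ) (hf : ∀ y, f y = fv (y 0))
    (hfin : ∑' i : ℕ, (fv i : ℝ≥0∞) * ν (cyl0 i) ≠ ⊤)
    (hinf : ∑' i : ℕ,
      (fv i : ℝ≥0∞) * ν (cyl0 i) * ENNReal.ofReal |Real.log (ν (cyl0 i)).toReal| = ⊤) :
    (∑' (i : ℕ) (k : ℕ),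
        if k ≤ fv i then
          ENNReal.ofReal (Real.negMulLog ((suspMeasure ν fv) (suspAtom i k)).toReal)
        else 0) = ⊤ := by
  set c : ℝ≥0∞ := ((∑' i : ℕ, (fv i : ℝ≥0∞) * ν (cyl0 i)) + 1)⁻¹ with hc
  have hc0 : c ≠ 0 := ENNReal.inv_ne_zero.mpr (ENNReal.add_ne_top.mpr ⟨hfin, ENNReal.one_ne_top⟩)
  have hc1 : c ≤ 1 := ENNReal.inv_le_one.mpr le_add_self
  rw [eq_top_iff, ← ENNReal.mul_top hc0, ← hinf, ← ENNReal.tsum_mul_left]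
  refine ENNReal.tsum_le_tsum fun i => ?_
  calc c * (fv i * ν (cyl0 i) * ENNReal.ofReal |Real.log (ν (cyl0 i)).toReal|)
      = ∑ _k ∈ Finset.range (fv i),
          c * (ν (cyl0 i) * ENNReal.ofReal |Real.log (ν (cyl0 i)).toReal|) := by
        rw [Finset.sum_const, Finset.card_range, nsmul_eq_mul]
        ring
    _ ≤ ∑ k ∈ Finset.range (fv i), if k ≤ fv i then
          ENNReal.ofReal (Real.negMulLog ((suspMeasure ν fv) (suspAtom i k)).toReal)
        else 0 := by
        refine Finset.sum_le_sum fun k hk => ?_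
        have hki : k ≤ fv i := (Finset.mem_range.mp hk).le
        rw [if_pos hki, suspMeasure_suspAtom ν hki]
        exact mul_ofReal_abs_log_le_ofReal_negMulLog hc0 hc1 prob_le_one
    _ ≤ _ := ENNReal.sum_le_tsum _
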